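/- Let n ≥ 2, μ > 0, and let p be a real number with 1 < p ≤ 1 + 2/(n−1). Let u₀, u₁ : ℝⁿ → ℝ be smooth compactly supported functions with ∫_{ℝⁿ} (u₁(x) − μ Δu₀(x)) dx > 0. Then there is no function u : [0,∞) × ℝⁿ → ℝ which is three times continuously differentiable, satisfies u(t,x) ≥ 0 for all (t,x), u(0,x) = u₀(x) and ∂_t u(0,x) = u₁(x) for all x, and solves ∂_t² u(t,x) − Δ_x u(t,x) − μ Δ_x (∂_t u)(t,x) = u(t,x)^p for all t ≥ 0 and x ∈ ℝⁿ. -/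

import Mathlib

open MeasureTheory

/-- The Laplacian of `f : ℝⁿ → ℝ`, as the sum of the second partial derivatives in the
coordinate directions. -/
noncomputable def lap (n : ℕ) (f : EuclideanSpace ℝ (Fin n) → ℝ)
    (x : EuclideanSpace ℝ (Fin n)) : ℝ :=
  ∑ j : Fin n,
    fderiv ℝ (fun y => fderiv ℝ f y (EuclideanSpace.single j 1)) x (EuclideanSpace.single j 1)

section DirectionalDerivatives

variable {E : Type*} [NormedAddCommGroup E] [NormedSpace ℝ E]

theorem ContDiff.fderiv_apply_const {f : E → ℝ} {k m : WithTop ℕ∞} (hf : ContDiff ℝ k f)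
    (hm : m + 1 ≤ k) (v : E) : ContDiff ℝ m (fun x => fderiv ℝ f x v) :=
  (hf.fderiv_right hm).clm_apply contDiff_const

theorem fderiv_pow_apply {f : E → ℝ} {x : E} (hf : DifferentiableAt ℝ f x) (k : ℕ) (v : E) :
    fderiv ℝ (fun y => f y ^ (k + 1)) x v = (k + 1) * f x ^ k * fderiv ℝ f x v := by
  rw [(hf.hasFDerivAt.pow (k + 1)).fderiv]
  simp

theorem fderiv_fderiv_pow_apply {f : E → ℝ} (hf : ContDiff ℝ 2 f) (k : ℕ) (v x : E) :
    fderiv ℝ (fun z => fderiv ℝ (fun y => f y ^ (k + 2)) z v) x v =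
      (k + 2) * f x ^ k * ((k + 1) * fderiv ℝ f x v ^ 2 +
        f x * fderiv ℝ (fun z => fderiv ℝ f z v) x v) := by
  have hd : Differentiable ℝ f := hf.differentiable (by norm_num)
  have hd' : Differentiable ℝ (fun z => fderiv ℝ f z v) :=
    (hf.fderiv_apply_const (m := 1) (by norm_num) v).differentiable (by norm_num)
  have h : (fun z => fderiv ℝ (fun y => f y ^ (k + 2)) z v) =
      fun z => ((k : ℝ) + 2) * (f z ^ (k + 1) * fderiv ℝ f z v) := by
    ext z
    rw [fderiv_pow_apply (hd z) (k + 1) v]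
    push_cast
    ring
  have hpow : DifferentiableAt ℝ (fun z => f z ^ (k + 1)) x := (hd x).pow _
  rw [h, fderiv_const_mul (hpow.fun_mul (hd' x)), fderiv_fun_mul hpow (hd' x)]
  simp only [add_apply, smul_apply, smul_eq_mul]
  rw [fderiv_pow_apply (hd x) k v]
  ring

theorem fderiv_comp_smul_apply (f : E → ℝ) (c : ℝ) (v x : E) :
    fderiv ℝ (fun y => f (c • y)) x v = c * fderiv ℝ f (c • x) v := by
  rw [fderiv_comp_smul]
  rfl

theorem fderiv_fderiv_comp_smul_apply (f : E → ℝ) (c : ℝ) (v x : E) :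
    fderiv ℝ (fun z => fderiv ℝ (fun y => f (c • y)) z v) x v =
      c ^ 2 * fderiv ℝ (fun z => fderiv ℝ f z v) (c • x) v := by
  simp_rw [fderiv_comp_smul_apply]
  change fderiv ℝ (c • fun z => fderiv ℝ f (c • z) v) x v = _
  rw [fderiv_const_smul_field]
  simp only [Pi.smul_apply, smul_apply, smul_eq_mul]
  rw [fderiv_comp_smul_apply (fun z => fderiv ℝ f z v)]
  ring

theorem fderiv_fderiv_apply_eq_zero_of_eqOn {f : E → ℝ} {s : Set E} (hs : IsOpen s) {c : ℝ}
    (hf : ∀ y ∈ s, f y = c) {x : E} (hx : x ∈ s) (v : E) :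
    fderiv ℝ f x v = 0 ∧ fderiv ℝ (fun z => fderiv ℝ f z v) x v = 0 := by
  have key : ∀ (g : E → ℝ) (d : ℝ), (∀ y ∈ s, g y = d) → ∀ y ∈ s, fderiv ℝ g y v = 0 := by
    intro g d hg y hy
    have : g =ᶠ[nhds y] fun _ => d := by
      filter_upwards [hs.mem_nhds hy] with z hz using hg z hz
    rw [this.fderiv_eq]
    simp
  exact ⟨key f c hf x hx, key _ 0 (key f c hf) x hx⟩

end DirectionalDerivatives

/-- A smooth cutoff at scale `R` whose first and second directional derivatives are controlled by
the power `r` of the cutoff itself. -/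
theorem exists_cutoff_family {E : Type*} [NormedAddCommGroup E] [InnerProductSpace ℝ E]
    [FiniteDimensional ℝ E] {r : ℝ} (hr₀ : 0 < r) (hr₁ : r < 1) :
    ∃ Ψ : ℝ → E → ℝ,
      (∀ R, 0 < R → ContDiff ℝ (⊤ : ℕ∞) (Ψ R) ∧ (∀ x, 0 ≤ Ψ R x) ∧ (∀ x, Ψ R x ≤ 1) ∧
        (∀ x, ‖x‖ < R → Ψ R x = 1) ∧ (∀ x, 2 * R ≤ ‖x‖ → Ψ R x = 0)) ∧
      ∀ v : E, ∃ C, 0 ≤ C ∧ ∀ R, 0 < R → ∀ x,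
        |fderiv ℝ (Ψ R) x v| ≤ C / R * Ψ R x ^ r ∧
        |fderiv ℝ (fun z => fderiv ℝ (Ψ R) z v) x v| ≤ C / R ^ 2 * Ψ R x ^ r := by
  obtain ⟨k, hk⟩ := exists_nat_ge (2 * r / (1 - r))
  have hkr : ((k : ℝ) + 2) * r ≤ k := by
    rw [div_le_iff₀ (by linarith)] at hk
    linarith
  let κ : ContDiffBump (0 : E) := ⟨1, 2, one_pos, one_lt_two⟩
  have hκ : ContDiff ℝ (⊤ : ℕ∞) κ := κ.contDiff
  have hκ2 : ContDiff ℝ 2 κ := κ.contDiff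
  have hpow : ∀ x, κ x ^ k ≤ (κ x ^ (k + 2)) ^ r := by
    intro x
    rcases κ.nonneg (x := x) |>.eq_or_lt with h | h
    · rcases k.eq_zero_or_pos with hk0 | hk0
      · exfalso
        rw [hk0] at hkr
        norm_num at hkr
        linarith
      · rw [← h, zero_pow hk0.ne']
        positivity
    · rw [← Real.rpow_natCast, ← Real.rpow_natCast, ← Real.rpow_mul h.le]
      exact Real.rpow_le_rpow_of_exponent_ge h κ.le_one (by push_cast; exact hkr)
  refine ⟨fun R x => κ (R⁻¹ • x) ^ (k + 2), fun R hR => ⟨?_, ?_, ?_, ?_, ?_⟩, fun v => ?_⟩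
  · exact (hκ.comp (contDiff_const_smul _)).pow _
  · intro x
    exact pow_nonneg κ.nonneg _
  · intro x
    exact pow_le_one₀ κ.nonneg κ.le_one
  · intro x hx
    dsimp only
    rw [κ.one_of_mem_closedBall, one_pow]
    rw [mem_closedBall_zero_iff, norm_smul, Real.norm_of_nonneg (by positivity)]
    exact (inv_mul_le_one₀ hR).2 hx.le
  · intro x hx
    dsimp only
    rw [κ.zero_of_le_dist, zero_pow (by omega)]
    rw [dist_zero_right, norm_smul, Real.norm_of_nonneg (by positivity), inv_mul_eq_div,
      le_div_iff₀ hR]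
    exact hx
  · have hc1 : ContDiff ℝ 1 (fun x => fderiv ℝ κ x v) :=
      hκ2.fderiv_apply_const (by norm_num) v
    have hc2 : Continuous (fun x => fderiv ℝ (fun z => fderiv ℝ κ z v) x v) :=
      (hc1.fderiv_apply_const (m := 0) (by norm_num) v).continuous
    obtain ⟨A, hA⟩ :=
      (κ.hasCompactSupport.fderiv_apply ℝ v).exists_bound_of_continuous hc1.continuous
    obtain ⟨B, hB⟩ :=
      ((κ.hasCompactSupport.fderiv_apply ℝ v).fderiv_apply ℝ v).exists_bound_of_continuous hc2
    have hA0 : 0 ≤ A := (norm_nonneg _).trans (hA 0)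
    have hB0 : 0 ≤ B := (norm_nonneg _).trans (hB 0)
    refine ⟨(k + 2) * A + (k + 2) * ((k + 1) * A ^ 2 + B), by positivity, fun R hR x => ?_⟩
    have hκ0 : 0 ≤ κ (R⁻¹ • x) := κ.nonneg
    have hκ1 : κ (R⁻¹ • x) ≤ 1 := κ.le_one
    have hp0 : 0 ≤ (κ (R⁻¹ • x) ^ (k + 2)) ^ r := by positivity
    constructor
    · rw [fderiv_comp_smul_apply (fun y => κ y ^ (k + 2)),
        fderiv_pow_apply (hκ2.differentiable (by norm_num) _) (k + 1) v]
      rw [abs_mul, abs_of_pos (inv_pos.2 hR), abs_mul, abs_of_nonneg (by positivity)]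
      have h1 : κ (R⁻¹ • x) ^ (k + 1) ≤ (κ (R⁻¹ • x) ^ (k + 2)) ^ r :=
        (pow_le_pow_of_le_one hκ0 hκ1 (Nat.le_succ k)).trans (hpow _)
      calc R⁻¹ * ((((k + 1 : ℕ) : ℝ) + 1) * κ (R⁻¹ • x) ^ (k + 1) * |fderiv ℝ κ (R⁻¹ • x) v|)
          ≤ R⁻¹ * ((((k + 1 : ℕ) : ℝ) + 1) * (κ (R⁻¹ • x) ^ (k + 2)) ^ r * A) := by
            gcongr
            exact hA _
        _ = ((k + 2) * A) / R * (κ (R⁻¹ • x) ^ (k + 2)) ^ r := by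
            push_cast
            field_simp
            ring
        _ ≤ _ := by
            gcongr
            linarith [show 0 ≤ ((k : ℝ) + 2) * ((k + 1) * A ^ 2 + B) by positivity]
    · rw [fderiv_fderiv_comp_smul_apply (fun y => κ y ^ (k + 2)),
        fderiv_fderiv_pow_apply hκ2 k v]
      rw [abs_mul, abs_of_pos (by positivity), abs_mul, abs_of_nonneg (by positivity)]
      have h2 : |((k : ℝ) + 1) * fderiv ℝ κ (R⁻¹ • x) v ^ 2 +
          κ (R⁻¹ • x) * fderiv ℝ (fun z => fderiv ℝ κ z v) (R⁻¹ • x) v| ≤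
          (k + 1) * A ^ 2 + B := by
        refine (abs_add_le _ _).trans (add_le_add ?_ ?_)
        · rw [abs_mul, abs_of_nonneg (by positivity), abs_pow]
          gcongr
          exact hA _
        · rw [abs_mul, abs_of_nonneg hκ0]
          exact (mul_le_of_le_one_left (abs_nonneg _) hκ1).trans (hB _)
      calc R⁻¹ ^ 2 * (((k : ℝ) + 2) * κ (R⁻¹ • x) ^ k *
            |((k : ℝ) + 1) * fderiv ℝ κ (R⁻¹ • x) v ^ 2 +
              κ (R⁻¹ • x) * fderiv ℝ (fun z => fderiv ℝ κ z v) (R⁻¹ • x) v|)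
          ≤ R⁻¹ ^ 2 * (((k : ℝ) + 2) * (κ (R⁻¹ • x) ^ (k + 2)) ^ r * ((k + 1) * A ^ 2 + B)) := by
            gcongr
            exact hpow _
        _ = ((k + 2) * ((k + 1) * A ^ 2 + B)) / R ^ 2 * (κ (R⁻¹ • x) ^ (k + 2)) ^ r := by
            field_simp
        _ ≤ _ := by
            gcongr
            linarith [show 0 ≤ ((k : ℝ) + 2) * A by positivity]

section Laplacian

variable {n : ℕ}

theorem continuous_lap {f : EuclideanSpace ℝ (Fin n) → ℝ} (hf : ContDiff ℝ 2 f) :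
    Continuous (lap n f) := by
  unfold lap
  exact continuous_finsetSum _ fun j _ =>
    ((hf.fderiv_apply_const (m := 1) (by norm_num) _).fderiv_apply_const
      (m := 0) (by norm_num) _).continuous

theorem hasCompactSupport_lap {f : EuclideanSpace ℝ (Fin n) → ℝ} (hf : HasCompactSupport f) :
    HasCompactSupport (lap n f) := by
  refine HasCompactSupport.intro (K := tsupport f) hf fun x hx => ?_
  exact Finset.sum_eq_zero fun j _ =>
    (fderiv_fderiv_apply_eq_zero_of_eqOn (isClosed_tsupport f).isOpen_compl
      (fun y hy => image_eq_zero_of_notMem_tsupport hy) hx _).2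

theorem integral_fderiv_mul_eq_neg {f g : EuclideanSpace ℝ (Fin n) → ℝ} (hf : ContDiff ℝ 1 f)
    (hg : ContDiff ℝ 1 g) (hs : HasCompactSupport g) (v : EuclideanSpace ℝ (Fin n)) :
    ∫ x, fderiv ℝ f x v * g x = - ∫ x, f x * fderiv ℝ g x v := by
  have hf' := (hf.fderiv_apply_const (m := 0) (by norm_num) v).continuous
  have hg' := (hg.fderiv_apply_const (m := 0) (by norm_num) v).continuous
  rw [integral_mul_fderiv_eq_neg_fderiv_mul_of_integrable, neg_neg]
  · exact (hf'.mul hg.continuous).integrable_of_hasCompactSupport hs.mul_left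
  · exact (hf.continuous.mul hg').integrable_of_hasCompactSupport
      (hs.fderiv_apply ℝ v).mul_left
  · exact (hf.continuous.mul hg.continuous).integrable_of_hasCompactSupport hs.mul_left
  · exact fun x _ => hf.differentiable (by norm_num) x
  · exact fun x _ => hg.differentiable (by norm_num) x

theorem integral_lap_mul {f g : EuclideanSpace ℝ (Fin n) → ℝ} (hf : ContDiff ℝ 2 f)
    (hg : ContDiff ℝ 2 g) (hs : HasCompactSupport g) :
    ∫ x, lap n f x * g x = ∫ x, f x * lap n g x := by
  unfold lap
  simp_rw [Finset.sum_mul, Finset.mul_sum]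
  have hf1 := fun v => hf.fderiv_apply_const (m := 1) (by norm_num) v
  have hg1 := fun v => hg.fderiv_apply_const (m := 1) (by norm_num) v
  have hf2 := fun v => ((hf1 v).fderiv_apply_const (m := 0) (by norm_num) v).continuous
  have hg2 := fun v => ((hg1 v).fderiv_apply_const (m := 0) (by norm_num) v).continuous
  rw [integral_finsetSum, integral_finsetSum]
  · refine Finset.sum_congr rfl fun j _ => ?_
    rw [integral_fderiv_mul_eq_neg (hf1 _) (hg.of_le (by norm_num)) hs,
      integral_fderiv_mul_eq_neg (hf.of_le (by norm_num)) (hg1 _) (hs.fderiv_apply ℝ _), neg_neg]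
  · exact fun j _ => (hf.continuous.mul (hg2 _)).integrable_of_hasCompactSupport
      ((hs.fderiv_apply ℝ _).fderiv_apply ℝ _).mul_left
  · exact fun j _ => ((hf2 _).mul hg.continuous).integrable_of_hasCompactSupport hs.mul_left

end Laplacian

section HalfSpace

variable {E : Type*} [NormedAddCommGroup E] [NormedSpace ℝ E]

theorem uniqueDiffOn_halfSpace : UniqueDiffOn ℝ {q : ℝ × E | 0 ≤ q.1} := by
  have : {q : ℝ × E | 0 ≤ q.1} = Set.Ici (0 : ℝ) ×ˢ Set.univ := by
    ext q
    simp
  rw [this]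
  exact (uniqueDiffOn_Ici 0).prod uniqueDiffOn_univ

theorem ContDiffOn.contDiff_slice {U : ℝ → E → ℝ} {m : WithTop ℕ∞}
    (hU : ContDiffOn ℝ m (fun q : ℝ × E => U q.1 q.2) {q | 0 ≤ q.1}) {t : ℝ} (ht : 0 ≤ t) :
    ContDiff ℝ m (U t) := by
  rw [← contDiffOn_univ]
  exact hU.comp (f := fun x => (t, x)) (contDiff_const.prodMk contDiff_id).contDiffOn
    fun x _ => ht

theorem ContDiffOn.time_derivWithin {U : ℝ → E → ℝ} {k m : WithTop ℕ∞}
    (hU : ContDiffOn ℝ k (fun q : ℝ × E => U q.1 q.2) {q | 0 ≤ q.1}) (hm : m + 1 ≤ k) :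
    ContDiffOn ℝ m (fun q : ℝ × E => derivWithin (fun s => U s q.2) (Set.Ici 0) q.1)
        {q | 0 ≤ q.1} ∧
      ∀ t x, 0 ≤ t → HasDerivWithinAt (fun s => U s x)
        (derivWithin (fun s => U s x) (Set.Ici 0) t) (Set.Ici 0) t := by
  have hk : k ≠ 0 := by
    rintro rfl
    simp at hm
  have key : ∀ t x, 0 ≤ t → HasDerivWithinAt (fun s => U s x)
      (fderivWithin ℝ (fun q : ℝ × E => U q.1 q.2) {q | 0 ≤ q.1} (t, x) (1, 0))
      (Set.Ici 0) t := by
    intro t x ht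
    have h1 : HasFDerivWithinAt (fun q : ℝ × E => U q.1 q.2)
        (fderivWithin ℝ (fun q : ℝ × E => U q.1 q.2) {q | 0 ≤ q.1} (t, x))
        {q | 0 ≤ q.1} ((fun s => (s, x)) t) :=
      (hU.differentiableOn hk (t, x) ht).hasFDerivWithinAt
    have h2 : HasDerivWithinAt (fun s : ℝ => (s, x)) ((1 : ℝ), (0 : E)) (Set.Ici 0) t :=
      (hasDerivWithinAt_id t _).prodMk (hasDerivWithinAt_const t _ x)
    exact h1.comp_hasDerivWithinAt t h2 fun s hs => hs
  refine ⟨?_, fun t x ht => (key t x ht).differentiableWithinAt.hasDerivWithinAt⟩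
  refine ((hU.fderivWithin uniqueDiffOn_halfSpace hm).clm_apply
    (contDiffOn_const (c := ((1 : ℝ), (0 : E))))).congr fun q hq => ?_
  exact (key q.1 q.2 hq).derivWithin (uniqueDiffOn_Ici 0 q.1 hq)

variable [MeasurableSpace E] [BorelSpace E] [FiniteDimensional ℝ E]

theorem integrable_halfSpace {F : ℝ × E → ℝ} (hF : ContinuousOn F {q | 0 ≤ q.1})
    {a : ℝ → ℝ} (ha : Continuous a) (ha' : HasCompactSupport a)
    {b : E → ℝ} (hb : Continuous b) (hb' : HasCompactSupport b) (ν : Measure E)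
    [ν.IsAddHaarMeasure] :
    Integrable (fun q : ℝ × E => F q * (a q.1 * b q.2))
      ((volume.restrict (Set.Ioi 0)).prod ν) := by
  have hG : Integrable (fun q : ℝ × E => F (max q.1 0, q.2) * (a q.1 * b q.2))
      ((volume : Measure ℝ).prod ν) := by
    refine Continuous.integrable_of_hasCompactSupport ?_ ?_
    · refine Continuous.mul ?_ (by fun_prop)
      exact hF.comp_continuous (by fun_prop) fun q => Set.mem_ofPred.2 (le_max_right _ _)
    · refine HasCompactSupport.intro (K := tsupport a ×ˢ tsupport b)
        (IsCompact.prod ha' hb') fun q hq => ?_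
      by_cases h : q.1 ∈ tsupport a
      · have h2 : q.2 ∉ tsupport b := fun h2 => hq ⟨h, h2⟩
        rw [image_eq_zero_of_notMem_tsupport h2, mul_zero, mul_zero]
      · rw [image_eq_zero_of_notMem_tsupport h, zero_mul, mul_zero]
  have hμ : (volume.restrict (Set.Ioi (0 : ℝ))).prod ν =
      ((volume : Measure ℝ).prod ν).restrict (Set.Ioi 0 ×ˢ Set.univ) := by
    rw [← Measure.prod_restrict, Measure.restrict_univ]
  rw [hμ]
  refine (hG.integrableOn (s := Set.Ioi 0 ×ˢ Set.univ)).congr_fun ?_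
    (measurableSet_Ioi.prod MeasurableSet.univ)
  intro q hq
  have : 0 ≤ q.1 := le_of_lt hq.1
  simp only [max_eq_left this]

end HalfSpace

theorem integral_Ioi_deriv_mul_add {f f' : ℝ → ℝ}
    (hf : ∀ t, 0 ≤ t → HasDerivWithinAt f (f' t) (Set.Ici 0) t)
    (hf' : ContinuousOn f' (Set.Ici 0)) {a : ℝ → ℝ} (ha : ContDiff ℝ 1 a)
    (hs : HasCompactSupport a) :
    ∫ t in Set.Ioi 0, (f' t * a t + f t * deriv a t) = - (f 0 * a 0) := by
  have hfc : ContinuousOn f (Set.Ici 0) := fun t ht => (hf t ht).continuousWithinAt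
  have hda : Continuous (deriv a) := ha.continuous_deriv le_rfl
  have hint : ∀ {g b : ℝ → ℝ}, ContinuousOn g (Set.Ici 0) → Continuous b →
      HasCompactSupport b → IntegrableOn (fun t => g t * b t) (Set.Ioi 0) := by
    intro g b hg hb hbs
    have : Integrable (fun t => g (max t 0) * b t) := by
      refine Continuous.integrable_of_hasCompactSupport ?_ hbs.mul_left
      exact (hg.comp_continuous (by fun_prop) fun q => Set.mem_Ici.2 (le_max_right _ _)).mul hb
    refine this.integrableOn.congr_fun (fun t ht => ?_) measurableSet_Ioi
    simp only [max_eq_left (le_of_lt (Set.mem_Ioi.1 ht))]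
  rw [integral_Ioi_of_hasDerivAt_of_tendsto (f := fun t => f t * a t) (m := 0), zero_sub]
  · exact (hfc 0 Set.self_mem_Ici).mul ha.continuous.continuousWithinAt
  · intro t ht
    exact ((hf t (le_of_lt ht)).hasDerivAt (Ici_mem_nhds ht)).mul
      (ha.differentiable (by norm_num) t).hasDerivAt
  · exact (hint hf' ha.continuous hs).add (hint hfc hda hs.deriv)
  · refine tendsto_const_nhds.congr' ?_
    have := hs.mul_left (f := f) |>.isCompact.isBounded.bddAbove
    obtain ⟨T, hT⟩ := this
    filter_upwards [Filter.eventually_gt_atTop T] with t ht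
    exact (image_eq_zero_of_notMem_tsupport (f := f * a)
      fun h => absurd (hT h) (not_le.2 ht)).symm

/-- Integration by parts in time on the half space, tested against a product. -/
theorem integral_halfSpace_time_deriv {E : Type*} [NormedAddCommGroup E] [NormedSpace ℝ E]
    [MeasurableSpace E] [BorelSpace E] [FiniteDimensional ℝ E] (ν : Measure E)
    [ν.IsAddHaarMeasure] {f f' : ℝ → E → ℝ}
    (hf : ∀ t x, 0 ≤ t → HasDerivWithinAt (fun s => f s x) (f' t x) (Set.Ici 0) t)
    (hfc : ContinuousOn (fun q : ℝ × E => f q.1 q.2) {q | 0 ≤ q.1})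
    (hfc' : ContinuousOn (fun q : ℝ × E => f' q.1 q.2) {q | 0 ≤ q.1})
    {a : ℝ → ℝ} (ha : ContDiff ℝ 1 a) (ha' : HasCompactSupport a)
    {b : E → ℝ} (hb : Continuous b) (hb' : HasCompactSupport b) :
    ∫ q, f' q.1 q.2 * (a q.1 * b q.2) ∂((volume.restrict (Set.Ioi (0 : ℝ))).prod ν) +
      ∫ q, f q.1 q.2 * (deriv a q.1 * b q.2) ∂((volume.restrict (Set.Ioi (0 : ℝ))).prod ν) =
      - (a 0 * ∫ x, f 0 x * b x ∂ν) := by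
  have i1 := integrable_halfSpace hfc' ha.continuous ha' hb hb' ν
  have i2 := integrable_halfSpace hfc (ha.continuous_deriv le_rfl) ha'.deriv hb hb' ν
  rw [← integral_add i1 i2, integral_prod_symm _ (i1.fun_add i2), ← integral_const_mul,
    ← integral_neg]
  refine integral_congr_ae (Filter.Eventually.of_forall fun x => ?_)
  have hcx : ContinuousOn (fun t => f' t x) (Set.Ici 0) :=
    hfc'.comp (f := fun t : ℝ => (t, x)) (by fun_prop) fun t ht => ht
  have := integral_Ioi_deriv_mul_add (fun t ht => hf t x ht) hcx ha ha'
  calc ∫ t in Set.Ioi 0, (f' t x * (a t * b x) + f t x * (deriv a t * b x))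
      = ∫ t in Set.Ioi 0, (f' t x * a t + f t x * deriv a t) * b x := by
        congr 1
        ext t
        ring
    _ = -(a 0 * (f 0 x * b x)) := by
        rw [integral_mul_const, this]
        ring

/-- The weak form of the equation, tested against a product `η(t) ψ(x)`. -/
theorem weak_identity {n : ℕ} {μ p : ℝ} (hp : 0 ≤ p)
    {u₀ u₁ : EuclideanSpace ℝ (Fin n) → ℝ} {u : ℝ → EuclideanSpace ℝ (Fin n) → ℝ}
    (hu : ContDiffOn ℝ 3 (fun q : ℝ × EuclideanSpace ℝ (Fin n) => u q.1 q.2) {q | 0 ≤ q.1})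
    (hu₀ : ∀ x, u 0 x = u₀ x)
    (hu₁ : ∀ x, derivWithin (fun s => u s x) (Set.Ici (0 : ℝ)) 0 = u₁ x)
    (heq : ∀ t x, 0 ≤ t →
      derivWithin (fun s => derivWithin (fun r => u r x) (Set.Ici (0 : ℝ)) s)
          (Set.Ici (0 : ℝ)) t
        - lap n (u t) x
        - μ * lap n (fun y => derivWithin (fun s => u s y) (Set.Ici (0 : ℝ)) t) x
      = u t x ^ p)
    {η : ℝ → ℝ} (hη : ContDiff ℝ 2 η) (hηs : HasCompactSupport η)
    (hη₀ : η 0 = 1) (hη₁ : deriv η 0 = 0)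
    {ψ : EuclideanSpace ℝ (Fin n) → ℝ} (hψ : ContDiff ℝ 2 ψ) (hψs : HasCompactSupport ψ) :
    ∫ q, u q.1 q.2 ^ p * (η q.1 * ψ q.2) ∂((volume.restrict (Set.Ioi (0 : ℝ))).prod volume) +
      ∫ x, (u₁ x - μ * lap n u₀ x) * ψ x =
    ∫ q, u q.1 q.2 * (deriv (deriv η) q.1 * ψ q.2 - η q.1 * lap n ψ q.2 +
      μ * (deriv η q.1 * lap n ψ q.2)) ∂((volume.restrict (Set.Ioi (0 : ℝ))).prod volume) := by
  set ut : ℝ → EuclideanSpace ℝ (Fin n) → ℝ :=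
    fun t x => derivWithin (fun s => u s x) (Set.Ici (0 : ℝ)) t
  set utt : ℝ → EuclideanSpace ℝ (Fin n) → ℝ :=
    fun t x => derivWithin (fun s => ut s x) (Set.Ici (0 : ℝ)) t
  obtain ⟨hutC, hutD⟩ := hu.time_derivWithin (m := 2) (by norm_num)
  obtain ⟨huttC, huttD⟩ := ContDiffOn.time_derivWithin (U := ut) (m := 1) hutC (by norm_num)
  have cu := hu.continuousOn
  have cut : ContinuousOn (fun q : ℝ × EuclideanSpace ℝ (Fin n) => ut q.1 q.2) {q | 0 ≤ q.1} :=
    hutC.continuousOn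
  have cutt : ContinuousOn (fun q : ℝ × EuclideanSpace ℝ (Fin n) => utt q.1 q.2)
    {q | 0 ≤ q.1} := huttC.continuousOn
  have cup : ContinuousOn (fun q : ℝ × EuclideanSpace ℝ (Fin n) => u q.1 q.2 ^ p)
    {q | 0 ≤ q.1} := cu.rpow_const fun _ _ => Or.inr hp
  have hη1 : ContDiff ℝ 1 η := hη.of_le (by norm_num)
  have hdη : ContDiff ℝ 1 (deriv η) := ((contDiff_succ_iff_deriv (n := 1)).1 (by simpa [one_add_one_eq_two] using hη)).2.2
  have cη := hη.continuous
  have cdη := hdη.continuous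
  have cddη : Continuous (deriv (deriv η)) := hdη.continuous_deriv le_rfl
  have cψ := hψ.continuous
  have clψ := continuous_lap hψ
  have slψ := hasCompactSupport_lap hψs
  have e1 := integral_halfSpace_time_deriv volume huttD cut cutt hη1 hηs cψ hψs
  have e2 := integral_halfSpace_time_deriv volume hutD cu cut hdη hηs.deriv cψ hψs
  have e3 := integral_halfSpace_time_deriv volume hutD cu cut hη1 hηs clψ slψ
  have j1 := integrable_halfSpace cutt cη hηs cψ hψs volume
  have j2 := integrable_halfSpace cu cη hηs clψ slψ volume
  have j3 := integrable_halfSpace cut cη hηs clψ slψ volume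
  have j4 := integrable_halfSpace cup cη hηs cψ hψs volume
  have j5 := integrable_halfSpace cu cddη hηs.deriv.deriv cψ hψs volume
  have j6 := integrable_halfSpace cu cdη hηs.deriv clψ slψ volume
  have e4 : ∫ q, (utt q.1 q.2 * (η q.1 * ψ q.2) - u q.1 q.2 * (η q.1 * lap n ψ q.2)
      - μ * (ut q.1 q.2 * (η q.1 * lap n ψ q.2)) - u q.1 q.2 ^ p * (η q.1 * ψ q.2))
      ∂((volume.restrict (Set.Ioi (0 : ℝ))).prod volume) = 0 := by
    rw [integral_prod _ (((j1.sub' j2).sub' (j3.const_mul μ)).sub' j4)]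
    refine setIntegral_eq_zero_of_forall_eq_zero fun t ht => ?_
    have ht' : 0 ≤ t := le_of_lt ht
    have c1 : ContDiff ℝ 2 (u t) := (hu.of_le (by norm_num)).contDiff_slice ht'
    have c2 : ContDiff ℝ 2 (ut t) := ContDiffOn.contDiff_slice (U := ut) hutC ht'
    have h1 := integral_lap_mul c1 hψ hψs
    have h2 := integral_lap_mul c2 hψ hψs
    have k1 : Integrable (fun x => lap n (u t) x * ψ x) :=
      ((continuous_lap c1).mul cψ).integrable_of_hasCompactSupport hψs.mul_left
    have k2 : Integrable (fun x => u t x * lap n ψ x) :=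
      (c1.continuous.mul clψ).integrable_of_hasCompactSupport slψ.mul_left
    have k3 : Integrable (fun x => lap n (ut t) x * ψ x) :=
      ((continuous_lap c2).mul cψ).integrable_of_hasCompactSupport hψs.mul_left
    have k4 : Integrable (fun x => ut t x * lap n ψ x) :=
      (c2.continuous.mul clψ).integrable_of_hasCompactSupport slψ.mul_left
    calc ∫ x, (utt t x * (η t * ψ x) - u t x * (η t * lap n ψ x)
          - μ * (ut t x * (η t * lap n ψ x)) - u t x ^ p * (η t * ψ x))
        = ∫ x, (η t * (lap n (u t) x * ψ x - u t x * lap n ψ x) +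
            η t * μ * (lap n (ut t) x * ψ x - ut t x * lap n ψ x)) := by
          congr 1
          ext x
          rw [← heq t x ht']
          ring
      _ = 0 := by
          rw [integral_add ((k1.sub' k2).const_mul _) ((k3.sub' k4).const_mul _),
            integral_const_mul, integral_const_mul, integral_sub k1 k2, integral_sub k3 k4,
            h1, h2]
          ring
  rw [integral_sub ((j1.sub' j2).sub' (j3.const_mul μ)) j4,
    integral_sub (j1.sub' j2) (j3.const_mul μ), integral_sub j1 j2, integral_const_mul] at e4
  have e5 : ∫ q, u q.1 q.2 * (deriv (deriv η) q.1 * ψ q.2 - η q.1 * lap n ψ q.2 +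
      μ * (deriv η q.1 * lap n ψ q.2)) ∂((volume.restrict (Set.Ioi (0 : ℝ))).prod volume) =
      ∫ q, (u q.1 q.2 * (deriv (deriv η) q.1 * ψ q.2) - u q.1 q.2 * (η q.1 * lap n ψ q.2) +
      μ * (u q.1 q.2 * (deriv η q.1 * lap n ψ q.2)))
      ∂((volume.restrict (Set.Ioi (0 : ℝ))).prod volume) := by
    congr 1
    ext q
    ring
  rw [integral_add (j5.sub' j2) (j6.const_mul μ), integral_sub j5 j2, integral_const_mul] at e5
  have c0 : ContDiff ℝ 2 u₀ := by
    have : u 0 = u₀ := funext hu₀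
    rw [← this]
    exact (hu.of_le (by norm_num)).contDiff_slice le_rfl
  have c1 : Continuous u₁ := by
    have : ut 0 = u₁ := funext hu₁
    rw [← this]
    exact (ContDiffOn.contDiff_slice (U := ut) hutC le_rfl).continuous
  have d1 : Integrable (fun x => u₁ x * ψ x) :=
    (c1.mul cψ).integrable_of_hasCompactSupport hψs.mul_left
  have d2 : Integrable (fun x => lap n u₀ x * ψ x) :=
    ((continuous_lap c0).mul cψ).integrable_of_hasCompactSupport hψs.mul_left
  have e6 : ∫ x, (u₁ x - μ * lap n u₀ x) * ψ x =
      (∫ x, u₁ x * ψ x) - μ * ∫ x, u₀ x * lap n ψ x := by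
    rw [← integral_lap_mul c0 hψ hψs, ← integral_const_mul, ← integral_sub d1 (d2.const_mul μ)]
    congr 1
    ext x
    ring
  rw [e5, e6]
  have hut0 : ∀ x, ut 0 x = u₁ x := hu₁
  simp only [hut0, hu₀, hη₀, hη₁] at e1 e2 e3
  linear_combination -e4 + e1 - e2 - μ * e3

/-- Test functions at scale `R`: the products `η(t) ψ(x)` are cutoffs for which the adjoint operator
is bounded by `R⁻²` times the power `r` of the product, and vanishes on the inner ball. -/
theorem exists_test_functions (n : ℕ) {μ r : ℝ} (hμ : 0 ≤ μ) (hr₀ : 0 < r) (hr₁ : r < 1) :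
    ∃ K, 0 ≤ K ∧ ∀ R, 1 ≤ R → ∃ (η : ℝ → ℝ) (ψ : EuclideanSpace ℝ (Fin n) → ℝ),
      ContDiff ℝ 2 η ∧ HasCompactSupport η ∧ η 0 = 1 ∧ deriv η 0 = 0 ∧
      ContDiff ℝ 2 ψ ∧ HasCompactSupport ψ ∧ (∀ x, ‖x‖ < R → ψ x = 1) ∧
      ∀ q : ℝ × EuclideanSpace ℝ (Fin n),
        0 ≤ η q.1 * ψ q.2 ∧ η q.1 * ψ q.2 ≤ 1 ∧
        (‖q‖ < R → η q.1 * ψ q.2 = 1 ∧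
          deriv (deriv η) q.1 * ψ q.2 - η q.1 * lap n ψ q.2 +
            μ * (deriv η q.1 * lap n ψ q.2) = 0) ∧
        (2 * R ≤ ‖q‖ → η q.1 * ψ q.2 = 0) ∧
        |deriv (deriv η) q.1 * ψ q.2 - η q.1 * lap n ψ q.2 +
            μ * (deriv η q.1 * lap n ψ q.2)| ≤ K / R ^ 2 * (η q.1 * ψ q.2) ^ r := by
  obtain ⟨T, hT, hTd⟩ := exists_cutoff_family (E := ℝ) hr₀ hr₁
  obtain ⟨Ψ, hΨ, hΨd⟩ := exists_cutoff_family (E := EuclideanSpace ℝ (Fin n)) hr₀ hr₁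
  obtain ⟨C, hC, hCT⟩ := hTd 1
  choose L hL hLΨ using fun j : Fin n => hΨd (EuclideanSpace.single j 1)
  have hLs : 0 ≤ ∑ j, L j := Finset.sum_nonneg fun j _ => hL j
  refine ⟨C + (∑ j, L j) + μ * (C * ∑ j, L j), by positivity, fun R hR => ?_⟩
  have hR0 : 0 < R := by linarith
  obtain ⟨T1, T2, T3, T4, T5⟩ := hT R hR0
  obtain ⟨P1, P2, P3, P4, P5⟩ := hΨ R hR0
  have hder : ∀ t, |t| < R → deriv (T R) t = 0 ∧ deriv (deriv (T R)) t = 0 := by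
    intro t ht
    have := fderiv_fderiv_apply_eq_zero_of_eqOn (Metric.isOpen_ball (x := (0 : ℝ)) (ε := R))
      (fun y hy => T4 y (mem_ball_zero_iff.1 hy)) (mem_ball_zero_iff.2 ht) 1
    simpa only [fderiv_apply_one_eq_deriv] using this
  have hlap0 : ∀ x, ‖x‖ < R → lap n (Ψ R) x = 0 := by
    intro x hx
    exact Finset.sum_eq_zero fun j _ => (fderiv_fderiv_apply_eq_zero_of_eqOn
      (Metric.isOpen_ball (x := (0 : EuclideanSpace ℝ (Fin n))) (ε := R))
      (fun y hy => P4 y (mem_ball_zero_iff.1 hy)) (mem_ball_zero_iff.2 hx) _).2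
  have hlap : ∀ x, |lap n (Ψ R) x| ≤ (∑ j, L j) / R ^ 2 * Ψ R x ^ r := by
    intro x
    rw [Finset.sum_div, Finset.sum_mul]
    exact (Finset.abs_sum_le_sum_abs _ _).trans
      (Finset.sum_le_sum fun j _ => (hLΨ j R hR0 x).2)
  have hself : ∀ {y : ℝ}, 0 ≤ y → y ≤ 1 → y ≤ y ^ r := by
    intro y h0 h1
    rcases h0.eq_or_lt with h | h
    · rw [← h, Real.zero_rpow hr₀.ne']
    · simpa using Real.rpow_le_rpow_of_exponent_ge h h1 hr₁.le
  refine ⟨T R, Ψ R, contDiff_infty.1 T1 2, ?_, T4 0 (by simpa using hR0),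
    (hder 0 (by simpa using hR0)).1, contDiff_infty.1 P1 2, ?_, P4, fun q => ?_⟩
  · refine HasCompactSupport.intro (isCompact_closedBall (0 : ℝ) (2 * R)) fun x hx => ?_
    exact T5 x (le_of_lt (by simpa using hx))
  · refine HasCompactSupport.intro
      (isCompact_closedBall (0 : EuclideanSpace ℝ (Fin n)) (2 * R)) fun x hx => ?_
    exact P5 x (le_of_lt (by simpa using hx))
  refine ⟨mul_nonneg (T2 _) (P2 _), mul_le_one₀ (T3 _) (P2 _) (P3 _), fun hq => ?_,
    fun hq => ?_, ?_⟩
  · rw [Prod.norm_def, max_lt_iff] at hq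
    rw [T4 _ hq.1, P4 _ hq.2, (hder _ hq.1).2, hlap0 _ hq.2]
    norm_num
  · rw [Prod.norm_def, le_max_iff] at hq
    rcases hq with hq | hq
    · rw [T5 _ hq, zero_mul]
    · rw [P5 _ hq, mul_zero]
  · have b1 := hCT R hR0 q.1
    simp only [fderiv_apply_one_eq_deriv] at b1
    have b2 := hlap q.2
    have t0 := T2 q.1
    have p0 := P2 q.2
    rw [Real.mul_rpow t0 p0]
    have tr := hself t0 (T3 q.1)
    have pr := hself p0 (P3 q.2)
    have tr0 : 0 ≤ T R q.1 ^ r := by positivity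
    have pr0 : 0 ≤ Ψ R q.2 ^ r := by positivity
    have a1 : |deriv (deriv (T R)) q.1 * Ψ R q.2| ≤ C / R ^ 2 * (T R q.1 ^ r * Ψ R q.2 ^ r) := by
      rw [abs_mul, abs_of_nonneg p0, ← mul_assoc]
      exact mul_le_mul b1.2 pr p0 (by positivity)
    have a2 : |T R q.1 * lap n (Ψ R) q.2| ≤
        (∑ j, L j) / R ^ 2 * (T R q.1 ^ r * Ψ R q.2 ^ r) := by
      rw [abs_mul, abs_of_nonneg t0, mul_left_comm]
      exact mul_le_mul tr b2 (abs_nonneg _) tr0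
    have a3 : |μ * (deriv (T R) q.1 * lap n (Ψ R) q.2)| ≤
        μ * (C * ∑ j, L j) / R ^ 2 * (T R q.1 ^ r * Ψ R q.2 ^ r) := by
      rw [abs_mul, abs_of_nonneg hμ, abs_mul]
      have hCR : C / R ≤ C := div_le_self hC hR
      calc μ * (|deriv (T R) q.1| * |lap n (Ψ R) q.2|)
          ≤ μ * ((C * T R q.1 ^ r) * ((∑ j, L j) / R ^ 2 * Ψ R q.2 ^ r)) := by
            gcongr
            exact b1.1.trans (by gcongr)
        _ = _ := by ring
    calc _ ≤ |deriv (deriv (T R)) q.1 * Ψ R q.2| + |T R q.1 * lap n (Ψ R) q.2| +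
          |μ * (deriv (T R) q.1 * lap n (Ψ R) q.2)| :=
          (abs_add_le _ _).trans (by gcongr; exact abs_sub _ _)
      _ ≤ _ := by
          refine (add_le_add (add_le_add a1 a2) a3).trans_eq ?_
          ring

/-- The bootstrap argument excluding positive mass: the functional inequality bounds `F`, hence
its dyadic increments tend to zero. -/
theorem mass_nonpos_of_functional_inequality {F I : ℝ → ℝ} {p q B m R₀ : ℝ} (hp : 1 < p)
    (hq : 0 < q) (hR₀ : 0 < R₀) (hF : ∀ R, 0 ≤ F R)
    (hFI : ∀ R, R₀ ≤ R → F R ≤ I R ∧ I R ≤ F (2 * R))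
    (h : ∀ R, R₀ ≤ R → ∀ s, 0 < s → I R + m ≤ s ^ p * (I R - F R) + s ^ (-q) * B) :
    m ≤ 0 := by
  by_contra! hm
  have hbound : ∀ R, R₀ ≤ R → F R ≤ 2 * ((1 / 2 : ℝ) ^ (-q) * B) := by
    intro R hR
    have h1 := h R hR (1 / 2) (by norm_num)
    have h2 : (1 / 2 : ℝ) ^ p ≤ 1 / 2 := by
      simpa using Real.rpow_le_rpow_of_exponent_ge (x := 1 / 2) (by norm_num) (by norm_num) hp.le
    have h3 := hFI R hR
    have h4 := mul_le_mul_of_nonneg_right h2 (sub_nonneg.2 h3.1)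
    linarith [hF R]
  let a : ℕ → ℝ := fun k => F (2 ^ k * R₀)
  have hk : ∀ k : ℕ, R₀ ≤ 2 ^ k * R₀ := fun k =>
    le_mul_of_one_le_left hR₀.le (one_le_pow₀ one_le_two)
  have hsucc : ∀ k, a (k + 1) = F (2 * (2 ^ k * R₀)) := fun k => by
    simp only [a]
    congr 1
    ring
  have hmono : Monotone a := monotone_nat_of_le_succ fun k => by
    rw [hsucc]
    exact (hFI _ (hk k)).1.trans (hFI _ (hk k)).2
  have hbdd : BddAbove (Set.range a) := ⟨_, by
    rintro _ ⟨k, rfl⟩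
    exact hbound _ (hk k)⟩
  have hlim := tendsto_atTop_ciSup hmono hbdd
  have hdiff : Filter.Tendsto (fun k => a (k + 1) - a k) Filter.atTop (nhds 0) := by
    simpa using (hlim.comp (Filter.tendsto_add_atTop_nat 1)).sub hlim
  have hs : ∀ s : ℝ, 0 < s → m ≤ s ^ (-q) * B := by
    intro s hs
    have h1 : Filter.Tendsto (fun k => s ^ p * (a (k + 1) - a k) + s ^ (-q) * B)
        Filter.atTop (nhds (s ^ (-q) * B)) := by
      simpa using (hdiff.const_mul (s ^ p)).add_const (s ^ (-q) * B)
    refine ge_of_tendsto' h1 fun k => ?_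
    have h2 := h _ (hk k) s hs
    have h3 := hFI _ (hk k)
    have h4 : s ^ p * (I (2 ^ k * R₀) - F (2 ^ k * R₀)) ≤ s ^ p * (a (k + 1) - a k) := by
      rw [hsucc]
      gcongr
      exact h3.2
    linarith [hF (2 ^ k * R₀)]
  have h0 : Filter.Tendsto (fun s : ℝ => s ^ (-q) * B) Filter.atTop (nhds 0) := by
    simpa using (tendsto_rpow_neg_atTop hq).mul_const B
  refine absurd (ge_of_tendsto h0 ?_) (not_le.2 hm)
  filter_upwards [Filter.eventually_gt_atTop 0] with s hs' using hs s hs'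

theorem mul_rpow_inv_mul_le_add {p q : ℝ} (hpq : p.HolderConjugate q) {a φ b s : ℝ} (ha : 0 ≤ a)
    (hφ : 0 ≤ φ) (hb : 0 ≤ b) (hs : 0 < s) :
    a * (b * φ ^ p⁻¹) ≤ s ^ p * (a ^ p * φ) + s ^ (-q) * b ^ q := by
  have h := Real.young_inequality_of_nonneg (a := s * a * φ ^ p⁻¹) (b := s⁻¹ * b)
    (by positivity) (by positivity) hpq
  have e1 : (s * a * φ ^ p⁻¹) ^ p = s ^ p * (a ^ p * φ) := by
    rw [Real.mul_rpow (by positivity) (by positivity), Real.mul_rpow hs.le ha,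
      Real.rpow_inv_rpow hφ hpq.ne_zero]
    ring
  have e2 : (s⁻¹ * b) ^ q = s ^ (-q) * b ^ q := by
    rw [Real.mul_rpow (by positivity) hb, Real.inv_rpow hs.le, Real.rpow_neg hs.le]
  have e3 : s * a * φ ^ p⁻¹ * (s⁻¹ * b) = a * (b * φ ^ p⁻¹) := by
    field_simp
  rw [e1, e2, e3] at h
  refine h.trans (add_le_add ?_ ?_)
  · exact div_le_self (by positivity) hpq.lt.le
  · exact div_le_self (by positivity) hpq.symm.lt.le

theorem exists_radius_eq_zero {E : Type*} [NormedAddCommGroup E] {f : E → ℝ}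
    (hf : HasCompactSupport f) : ∃ R, ∀ x, R ≤ ‖x‖ → f x = 0 := by
  obtain ⟨R, hR⟩ := hf.isCompact.isBounded.exists_norm_le
  refine ⟨R + 1, fun x hx => image_eq_zero_of_notMem_tsupport fun h => ?_⟩
  linarith [hR x h]

/-- The quantitative inequality obtained from a single pair of test functions at scale `R`, for a
density `w` of the adjoint operator applied to the cutoff `φ`. -/
theorem functional_inequality_at_scale {n : ℕ} {p q : ℝ} (hpq : p.HolderConjugate q)
    (hn : (n : ℝ) + 1 ≤ 2 * q) {u φ w : ℝ × EuclideanSpace ℝ (Fin n) → ℝ}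
    {N : Measure (ℝ × EuclideanSpace ℝ (Fin n))} (hN : N ≤ volume)
    (hu : ∀ᵐ z ∂N, 0 ≤ u z) {K R m : ℝ} (hK : 0 ≤ K) (hR : 1 ≤ R)
    (hφ₀ : ∀ z, 0 ≤ φ z) (hφ₁ : ∀ z, φ z ≤ 1)
    (hin : ∀ z, ‖z‖ < R → φ z = 1 ∧ w z = 0) (hout : ∀ z, 2 * R ≤ ‖z‖ → φ z = 0)
    (hw : ∀ z, |w z| ≤ K / R ^ 2 * φ z ^ p⁻¹)
    (hint : Integrable (fun z => u z ^ p * φ z) N)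
    (hint' : IntegrableOn (fun z => u z ^ p) (Metric.ball 0 (2 * R)) N)
    (hid : ∫ z, u z ^ p * φ z ∂N + m = ∫ z, u z * w z ∂N) :
    (∫ z in Metric.ball 0 R, u z ^ p ∂N ≤ ∫ z, u z ^ p * φ z ∂N) ∧
    (∫ z, u z ^ p * φ z ∂N ≤ ∫ z in Metric.ball 0 (2 * R), u z ^ p ∂N) ∧
    ∀ s, 0 < s → ∫ z, u z ^ p * φ z ∂N + m ≤
      s ^ p * (∫ z, u z ^ p * φ z ∂N - ∫ z in Metric.ball 0 R, u z ^ p ∂N) +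
      s ^ (-q) * (K ^ q * 2 ^ (n + 1) *
        (volume (Metric.ball (0 : ℝ × EuclideanSpace ℝ (Fin n)) 1)).toReal) := by
  have hR0 : 0 < R := by linarith
  have hb : ∀ ρ : ℝ, MeasurableSet (Metric.ball (0 : ℝ × EuclideanSpace ℝ (Fin n)) ρ) :=
    fun ρ => measurableSet_ball
  have hpos : ∀ᵐ z ∂N, 0 ≤ u z ^ p * φ z := by
    filter_upwards [hu] with z hz
    have := hφ₀ z
    positivity
  have hFin : ∫ z in Metric.ball 0 R, u z ^ p ∂N = ∫ z in Metric.ball 0 R, u z ^ p * φ z ∂N := by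
    refine setIntegral_congr_fun (hb R) fun z hz => ?_
    simp only [(hin z (mem_ball_zero_iff.1 hz)).1, mul_one]
  have hvol : (N (Metric.ball 0 (2 * R))).toReal ≤ R ^ (n + 1) * (2 ^ (n + 1) *
      (volume (Metric.ball (0 : ℝ × EuclideanSpace ℝ (Fin n)) 1)).toReal) := by
    have : (volume : Measure (ℝ × EuclideanSpace ℝ (Fin n))).IsAddHaarMeasure := by
      rw [Measure.volume_eq_prod]
      infer_instance
    have h1 : volume (Metric.ball (0 : ℝ × EuclideanSpace ℝ (Fin n)) (2 * R)) =
        ENNReal.ofReal ((2 * R) ^ (n + 1)) *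
          volume (Metric.ball (0 : ℝ × EuclideanSpace ℝ (Fin n)) 1) := by
      rw [Measure.addHaar_ball _ _ (by positivity)]
      congr 3
      simp [add_comm]
    have h2 := ENNReal.toReal_mono measure_ball_lt_top.ne (hN (Metric.ball 0 (2 * R)))
    rw [h1, ENNReal.toReal_mul, ENNReal.toReal_ofReal (by positivity), mul_pow] at h2
    linarith
  have hfin : N (Metric.ball 0 (2 * R)) ≠ ⊤ :=
    ((hN _).trans_lt measure_ball_lt_top).ne
  refine ⟨?_, ?_, fun s hs => ?_⟩
  · rw [hFin]
    exact setIntegral_le_integral hint hpos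
  · rw [← integral_indicator (hb (2 * R))]
    refine integral_mono_ae hint (hint'.integrable_indicator (hb (2 * R))) ?_
    filter_upwards [hu] with z hz
    by_cases hz2 : z ∈ Metric.ball 0 (2 * R)
    · rw [Set.indicator_of_mem hz2]
      exact mul_le_of_le_one_right (by positivity) (hφ₁ z)
    · rw [Set.indicator_of_notMem hz2]
      rw [mem_ball_zero_iff, not_lt] at hz2
      simp [hout z hz2]
  · set c : ℝ := s ^ (-q) * (K / R ^ 2) ^ q with hc
    have hc0 : 0 ≤ c := by positivity
    have hrhs : Integrable (fun z => s ^ p * (u z ^ p * φ z -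
        (Metric.ball 0 R).indicator (fun z => u z ^ p * φ z) z) +
        (Metric.ball 0 (2 * R)).indicator (fun _ => c) z) N := by
      refine ((hint.sub' (hint.indicator (hb R))).const_mul _).fun_add ?_
      exact (integrable_indicator_iff (hb _)).2 (integrableOn_const hfin)
    have hle : ∫ z, u z * w z ∂N ≤ ∫ z, (s ^ p * (u z ^ p * φ z -
        (Metric.ball 0 R).indicator (fun z => u z ^ p * φ z) z) +
        (Metric.ball 0 (2 * R)).indicator (fun _ => c) z) ∂N := by
      by_cases hi : Integrable (fun z => u z * w z) N
      swap
      · rw [integral_undef hi]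
        refine integral_nonneg_of_ae ?_
        filter_upwards [hpos] with z hz
        refine add_nonneg (mul_nonneg (by positivity) (sub_nonneg.2 ?_))
          (Set.indicator_nonneg (fun _ _ => hc0) _)
        exact Set.indicator_le_self' (fun _ _ => hz) z
      refine integral_mono_ae hi hrhs ?_
      filter_upwards [hu, hpos] with z hz hzp
      by_cases h1 : z ∈ Metric.ball 0 R
      · rw [Set.indicator_of_mem h1, (hin z (mem_ball_zero_iff.1 h1)).2, mul_zero, sub_self,
          mul_zero, zero_add]
        exact Set.indicator_nonneg (fun _ _ => hc0) _
      rw [Set.indicator_of_notMem h1, sub_zero]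
      by_cases h2 : z ∈ Metric.ball 0 (2 * R)
      · rw [Set.indicator_of_mem h2]
        calc u z * w z ≤ u z * (K / R ^ 2 * φ z ^ p⁻¹) :=
              mul_le_mul_of_nonneg_left ((le_abs_self _).trans (hw z)) hz
          _ ≤ _ := mul_rpow_inv_mul_le_add hpq hz (hφ₀ z) (by positivity) hs
      · rw [Set.indicator_of_notMem h2]
        rw [mem_ball_zero_iff, not_lt] at h2
        have h3 := hw z
        rw [hout z h2, Real.zero_rpow (inv_ne_zero hpq.ne_zero), mul_zero] at h3
        rw [abs_nonpos_iff.1 h3, hout z h2]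
        simp
    rw [integral_add ((hint.sub' (hint.indicator (hb R))).const_mul _)
      ((integrable_indicator_iff (hb _)).2 (integrableOn_const hfin)), integral_const_mul,
      integral_sub hint (hint.indicator (hb R)), integral_indicator (hb R),
      integral_indicator (hb (2 * R)), setIntegral_const, ← hFin, ← hid] at hle
    refine hle.trans (add_le_add le_rfl ?_)
    rw [smul_eq_mul, measureReal_def]
    have hRq : R ^ (n + 1) ≤ (R ^ 2) ^ q := by
      rw [← Real.rpow_natCast, ← Real.rpow_natCast, ← Real.rpow_mul hR0.le]
      exact Real.rpow_le_rpow_of_exponent_le hR (by push_cast; exact hn)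
    set b := (volume (Metric.ball (0 : ℝ × EuclideanSpace ℝ (Fin n)) 1)).toReal
    have hb0 : 0 ≤ b := ENNReal.toReal_nonneg
    calc (N (Metric.ball 0 (2 * R))).toReal * c
        ≤ ((R ^ 2) ^ q * (2 ^ (n + 1) * b)) * (s ^ (-q) * (K ^ q / (R ^ 2) ^ q)) := by
          rw [hc, Real.div_rpow hK (by positivity)]
          gcongr
          exact hvol.trans (by gcongr)
      _ = _ := by
          have : 0 < (R ^ 2) ^ q := by positivity
          field_simp

/-- Blow-up for the semilinear visco-elastic damped wave equation
`u_tt − Δu − μ Δ u_t = u^p` (the case `σ = 1` of the paper), with subcritical exponent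
`1 < p ≤ 1 + 2/(n−1)` and data with positive total mass `∫ (u₁ − μ Δu₀) > 0`:
no nonnegative global `C³` solution exists. -/
theorem no_global_nonnegative_solution_sigma_one
    (n : ℕ) (hn : 2 ≤ n) (μ p : ℝ) (hμ : 0 < μ)
    (hp₁ : 1 < p) (hp₂ : p ≤ 1 + 2 / ((n : ℝ) - 1))
    (u₀ u₁ : EuclideanSpace ℝ (Fin n) → ℝ)
    (hu₀smooth : ContDiff ℝ (⊤ : ℕ∞) u₀) (hu₁smooth : ContDiff ℝ (⊤ : ℕ∞) u₁)
    (hu₀supp : HasCompactSupport u₀) (hu₁supp : HasCompactSupport u₁)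
    (hdata : 0 < ∫ x, (u₁ x - μ * lap n u₀ x)) :
    ¬ ∃ u : ℝ → EuclideanSpace ℝ (Fin n) → ℝ,
        ContDiffOn ℝ 3 (fun q : ℝ × EuclideanSpace ℝ (Fin n) => u q.1 q.2)
          {q : ℝ × EuclideanSpace ℝ (Fin n) | 0 ≤ q.1} ∧
        (∀ t x, 0 ≤ t → 0 ≤ u t x) ∧
        (∀ x, u 0 x = u₀ x) ∧
        (∀ x, derivWithin (fun s => u s x) (Set.Ici (0 : ℝ)) 0 = u₁ x) ∧
        (∀ t x, 0 ≤ t →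
          derivWithin (fun s => derivWithin (fun r => u r x) (Set.Ici (0 : ℝ)) s)
              (Set.Ici (0 : ℝ)) t
            - lap n (u t) x
            - μ * lap n (fun y => derivWithin (fun s => u s y) (Set.Ici (0 : ℝ)) t) x
          = u t x ^ p) := by
  rintro ⟨u, hu, hpos, hu₀, hu₁, heq⟩
  have hp0 : 0 < p := by linarith
  have hn1 : (0 : ℝ) < (n : ℝ) - 1 := by
    have : (2 : ℝ) ≤ n := by exact_mod_cast hn
    linarith
  have hpq : p.HolderConjugate (p / (p - 1)) := Real.HolderConjugate.conjExponent hp₁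
  have hnq : (n : ℝ) + 1 ≤ 2 * (p / (p - 1)) := by
    have h1 : (p - 1) * ((n : ℝ) - 1) ≤ 2 := by
      rw [← le_div_iff₀ hn1]
      linarith
    rw [← mul_div_assoc, le_div_iff₀ (by linarith)]
    linarith
  obtain ⟨K, hK, htest⟩ := exists_test_functions n hμ.le (inv_pos.2 hp0) (inv_lt_one_of_one_lt₀ hp₁)
  obtain ⟨R₁, hR₁⟩ := exists_radius_eq_zero hu₁supp
  obtain ⟨R₂, hR₂⟩ := exists_radius_eq_zero (hasCompactSupport_lap hu₀supp)
  set N : Measure (ℝ × EuclideanSpace ℝ (Fin n)) :=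
    (volume.restrict (Set.Ioi (0 : ℝ))).prod volume with hN
  have hNr : N = volume.restrict (Set.Ioi (0 : ℝ) ×ˢ Set.univ) := by
    rw [hN, Measure.volume_eq_prod, ← Measure.prod_restrict, Measure.restrict_univ]
  have hNle : N ≤ volume := hNr ▸ Measure.restrict_le_self
  have hNpos : ∀ᵐ z ∂N, 0 ≤ u z.1 z.2 := by
    rw [hNr]
    filter_upwards [ae_restrict_mem (measurableSet_Ioi.prod MeasurableSet.univ)] with z hz
    exact hpos _ _ (le_of_lt hz.1)
  choose! η ψ hη hηs hη₀ hη₁ hψ hψs hψ₁ hφ using htest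
  have cup : ContinuousOn (fun z : ℝ × EuclideanSpace ℝ (Fin n) => u z.1 z.2 ^ p)
    {z | 0 ≤ z.1} := hu.continuousOn.rpow_const fun _ _ => Or.inr hp0.le
  have hint : ∀ R, 1 ≤ R → Integrable (fun z => u z.1 z.2 ^ p * (η R z.1 * ψ R z.2)) N :=
    fun R hR => integrable_halfSpace cup (hη R hR).continuous (hηs R hR)
      (hψ R hR).continuous (hψs R hR) volume
  have hint' : ∀ R, 1 ≤ R → IntegrableOn (fun z => u z.1 z.2 ^ p) (Metric.ball 0 R) N := by
    intro R hR
    refine (hint R hR).integrableOn.congr_fun (fun z hz => ?_) measurableSet_ball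
    simp only [((hφ R hR z).2.2.1 (mem_ball_zero_iff.1 hz)).1, mul_one]
  have hmain : ∀ R, max 1 (max R₁ R₂) ≤ R → _ := fun R hR =>
    have hR1 : 1 ≤ R := (le_max_left _ _).trans hR
    functional_inequality_at_scale hpq hnq (u := fun z => u z.1 z.2)
      (φ := fun z => η R z.1 * ψ R z.2) (m := ∫ x, (u₁ x - μ * lap n u₀ x)) hNle hNpos hK hR1
      (fun z => (hφ R hR1 z).1) (fun z => (hφ R hR1 z).2.1) (fun z => (hφ R hR1 z).2.2.1)
      (fun z => (hφ R hR1 z).2.2.2.1) (fun z => (hφ R hR1 z).2.2.2.2) (hint R hR1)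
      (hint' (2 * R) (by linarith)) (by
        rw [← weak_identity hp0.le hu hu₀ hu₁ heq (hη R hR1) (hηs R hR1) (hη₀ R hR1)
          (hη₁ R hR1) (hψ R hR1) (hψs R hR1)]
        congr 2
        ext x
        by_cases hx : ‖x‖ < R
        · rw [hψ₁ R hR1 x hx, mul_one]
        · have hx' : R ≤ ‖x‖ := not_lt.1 hx
          have hR3 := (le_max_right _ _).trans hR
          rw [hR₁ x (((le_max_left _ _).trans hR3).trans hx'),
            hR₂ x (((le_max_right _ _).trans hR3).trans hx')]
          ring)
  refine absurd (mass_nonpos_of_functional_inequality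
    (F := fun R => ∫ z in Metric.ball 0 R, u z.1 z.2 ^ p ∂N) hp₁ hpq.symm.pos
    (lt_of_lt_of_le one_pos (le_max_left 1 (max R₁ R₂))) ?_
    (fun R hR => ⟨(hmain R hR).1, (hmain R hR).2.1⟩) fun R hR => (hmain R hR).2.2)
    (not_le.2 hdata)
  intro R
  refine integral_nonneg_of_ae (ae_restrict_of_ae ?_)
  filter_upwards [hNpos] with z hz using Real.rpow_nonneg hz p
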